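/- arXiv:2505.09206 — 2 statements merged into one kernel-verified Lean document; each statement's English description precedes it below -/
import Mathlib

section
/- Let n ≥ 1 and let ρ be a 2ⁿ×2ⁿ density matrix. Then each of the 4ⁿ numbers Tr(P_v ρ), for v ranging over all Pauli strings, is real, and 4^{−n} Σ_v Tr(P_v ρ)⁴ ≤ 2^{−n} Tr(ρ²) ≤ 2^{−n}. -/
open Matrix ComplexOrder

/-- The four single-qubit Pauli matrices `I, X, Y, Z`. -/
noncomputable def pauliMat : Fin 4 → Matrix (Fin 2) (Fin 2) ℂ
  | 0 => 1
  | 1 => !![0, 1; 1, 0]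
  | 2 => !![0, -Complex.I; Complex.I, 0]
  | 3 => !![1, 0; 0, -1]

/-- The Pauli string `P_v = σ_{v 0} ⊗ ⋯ ⊗ σ_{v (n-1)}` as a `2ⁿ × 2ⁿ` matrix
indexed by functions `Fin n → Fin 2`. -/
noncomputable def pauliString {n : ℕ} (v : Fin n → Fin 4) :
    Matrix (Fin n → Fin 2) (Fin n → Fin 2) ℂ :=
  Matrix.of fun a b => ∏ i, pauliMat (v i) (a i) (b i)

lemma pauliMat_conjTranspose (k : Fin 4) : (pauliMat k)ᴴ = pauliMat k := by
  ext a b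
  fin_cases k <;> fin_cases a <;> fin_cases b <;> simp [pauliMat]

lemma pauliMat_mul_self (k : Fin 4) : pauliMat k * pauliMat k = 1 := by
  ext a b
  fin_cases k <;> fin_cases a <;> fin_cases b <;> simp [pauliMat, Matrix.mul_apply]

lemma sum_pauliMat_apply_mul_apply (a b c d : Fin 2) :
    ∑ k, pauliMat k a b * pauliMat k c d = if a = d ∧ b = c then 2 else 0 := by
  fin_cases a <;> fin_cases b <;> fin_cases c <;> fin_cases d <;>
    simp [pauliMat, Fin.sum_univ_four] <;> norm_num

lemma pauliString_isHermitian {n : ℕ} (v : Fin n → Fin 4) : (pauliString v).IsHermitian := by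
  ext a b
  simp only [conjTranspose_apply, pauliString, of_apply, star_prod]
  exact Finset.prod_congr rfl fun i _ => congrFun₂ (pauliMat_conjTranspose (v i)) (a i) (b i)

lemma pauliString_mul_self {n : ℕ} (v : Fin n → Fin 4) : pauliString v * pauliString v = 1 := by
  ext a c
  simp only [Matrix.mul_apply, pauliString, of_apply, ← Finset.prod_mul_distrib]
  rw [← Fintype.piFinset_univ,
    ← Finset.prod_univ_sum (fun _ => Finset.univ)
      fun i x => pauliMat (v i) (a i) x * pauliMat (v i) x (c i)]
  simp only [← Matrix.mul_apply, pauliMat_mul_self, Matrix.one_apply, Finset.prod_ite_zero,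
    Finset.mem_univ, true_imp_iff, Finset.prod_const_one, funext_iff]

lemma sum_pauliString_apply_mul_apply {n : ℕ} (a b c d : Fin n → Fin 2) :
    ∑ v, pauliString v a b * pauliString v c d = if a = d ∧ b = c then 2 ^ n else 0 := by
  simp only [pauliString, of_apply, ← Finset.prod_mul_distrib]
  rw [← Fintype.piFinset_univ,
    ← Finset.prod_univ_sum (fun _ => Finset.univ)
      fun i k => pauliMat k (a i) (b i) * pauliMat k (c i) (d i)]
  simp only [sum_pauliMat_apply_mul_apply, Finset.prod_ite_zero, Finset.mem_univ, true_imp_iff,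
    Finset.prod_const, Finset.card_univ, Fintype.card_fin, funext_iff, forall_and]

lemma sum_trace_pauliString_mul_sq {n : ℕ} (A : Matrix (Fin n → Fin 2) (Fin n → Fin 2) ℂ) :
    ∑ v, trace (pauliString v * A) ^ 2 = 2 ^ n * trace (A * A) := by
  calc ∑ v, trace (pauliString v * A) ^ 2
      = ∑ v, ∑ a, ∑ b, ∑ c, ∑ d,
          pauliString v a b * pauliString v c d * (A b a * A d c) := by
        refine Finset.sum_congr rfl fun v _ => ?_
        simp only [sq, trace, diag_apply, Matrix.mul_apply, Finset.sum_mul]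
        refine Finset.sum_congr rfl fun a _ => Finset.sum_congr rfl fun b _ => ?_
        simp only [Finset.mul_sum]
        exact Finset.sum_congr rfl fun c _ => Finset.sum_congr rfl fun d _ => by ring
    _ = ∑ a, ∑ b, ∑ c, ∑ d,
          (∑ v, pauliString v a b * pauliString v c d) * (A b a * A d c) := by
        simp only [Finset.sum_mul]
        rw [Finset.sum_comm]
        refine Finset.sum_congr rfl fun a _ => ?_
        rw [Finset.sum_comm]
        refine Finset.sum_congr rfl fun b _ => ?_
        rw [Finset.sum_comm]
        refine Finset.sum_congr rfl fun c _ => ?_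
        rw [Finset.sum_comm]
    _ = 2 ^ n * trace (A * A) := by
        simp only [sum_pauliString_apply_mul_apply, ite_and, ite_mul, zero_mul, trace, diag_apply,
          Matrix.mul_apply, Finset.mul_sum]
        refine Finset.sum_congr rfl fun a _ => Finset.sum_congr rfl fun b _ => ?_
        simp [mul_comm (A a b)]

lemma Matrix.IsHermitian.im_trace_mul_eq_zero {ι : Type*} [Fintype ι] {A B : Matrix ι ι ℂ}
    (hA : A.IsHermitian) (hB : B.IsHermitian) : (trace (A * B)).im = 0 := by
  rw [← Complex.conj_eq_iff_im, starRingEnd_apply, ← trace_conjTranspose, conjTranspose_mul,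
    hA.eq, hB.eq, trace_mul_comm]

lemma Matrix.PosSemidef.neg_re_trace_le_re_trace_mul {ι : Type*} [Fintype ι] [DecidableEq ι]
    {ρ U : Matrix ι ι ℂ} (hρ : ρ.PosSemidef) (hU : U.IsHermitian) (hUU : U * U = 1) :
    -(trace ρ).re ≤ (trace (U * ρ)).re := by
  have h : 0 ≤ trace ((1 + U) * ρ * (1 + U)ᴴ) :=
    (hρ.mul_mul_conjTranspose_same (1 + U)).trace_nonneg
  have e : trace ((1 + U) * ρ * (1 + U)ᴴ) = 2 * (trace ρ + trace (U * ρ)) := by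
    have hsq : (1 + U) * (1 + U) = (2 : ℂ) • (1 + U) := by
      rw [add_mul, mul_add, mul_add, hUU, two_smul]
      simp only [one_mul, mul_one]
      abel
    rw [conjTranspose_add, conjTranspose_one, hU.eq, trace_mul_comm, ← Matrix.mul_assoc, hsq,
      smul_mul, trace_smul, add_mul, one_mul, trace_add, smul_eq_mul]
  rw [e] at h
  have h' := (Complex.le_def.1 h).1
  simp at h'
  linarith

lemma Matrix.PosSemidef.abs_re_trace_mul_le {ι : Type*} [Fintype ι] [DecidableEq ι]
    {ρ U : Matrix ι ι ℂ} (hρ : ρ.PosSemidef) (hU : U.IsHermitian) (hUU : U * U = 1) :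
    |(trace (U * ρ)).re| ≤ (trace ρ).re := by
  have h₁ := hρ.neg_re_trace_le_re_trace_mul hU hUU
  have h₂ := hρ.neg_re_trace_le_re_trace_mul hU.neg (by rwa [neg_mul_neg])
  rw [neg_mul, trace_neg, Complex.neg_re] at h₂
  exact abs_le.2 ⟨h₁, by linarith⟩

lemma Matrix.PosSemidef.trace_mul_self_le {ι : Type*} [Fintype ι]
    {ρ : Matrix ι ι ℂ} (hρ : ρ.PosSemidef) : trace (ρ * ρ) ≤ trace ρ ^ 2 := by
  simp only [sq, trace, diag_apply, Matrix.mul_apply, Finset.sum_mul_sum]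
  refine Finset.sum_le_sum fun a _ => Finset.sum_le_sum fun b _ => ?_
  have h := (hρ.submatrix ![a, b]).det_nonneg
  rw [det_fin_two] at h
  simpa using h

/-- For any `n`-qubit density matrix `ρ`, all `Tr(P_v ρ)` are real, and
`4^{−n} Σ_v Tr(P_v ρ)⁴ ≤ 2^{−n} Tr(ρ²) ≤ 2^{−n}`. -/
theorem pauli_fourth_moment_le {n : ℕ} (hn : 1 ≤ n)
    (ρ : Matrix (Fin n → Fin 2) (Fin n → Fin 2) ℂ)
    (hρ : ρ.PosSemidef) (hρtr : ρ.trace = 1) :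
    (∀ v : Fin n → Fin 4, (trace (pauliString v * ρ)).im = 0) ∧
      ((4 : ℝ) ^ n)⁻¹ * ∑ v : Fin n → Fin 4, (trace (pauliString v * ρ)).re ^ 4 ≤
        ((2 : ℝ) ^ n)⁻¹ * (trace (ρ * ρ)).re ∧
      ((2 : ℝ) ^ n)⁻¹ * (trace (ρ * ρ)).re ≤ ((2 : ℝ) ^ n)⁻¹ := by
  have him (v : Fin n → Fin 4) : (trace (pauliString v * ρ)).im = 0 :=
    (pauliString_isHermitian v).im_trace_mul_eq_zero hρ.isHermitian
  have hparseval : ∑ v : Fin n → Fin 4, (trace (pauliString v * ρ)).re ^ 2 =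
      2 ^ n * (trace (ρ * ρ)).re := by
    have h := congrArg Complex.re (sum_trace_pauliString_mul_sq ρ)
    rw [Complex.re_sum, show (2 : ℂ) ^ n = ((2 ^ n : ℝ) : ℂ) by push_cast; rfl,
      Complex.re_ofReal_mul] at h
    simpa [sq, him] using h
  have hfourth (v : Fin n → Fin 4) :
      (trace (pauliString v * ρ)).re ^ 4 ≤ (trace (pauliString v * ρ)).re ^ 2 := by
    have h := hρ.abs_re_trace_mul_le (pauliString_isHermitian v) (pauliString_mul_self v)
    rw [hρtr, Complex.one_re, ← sq_le_one_iff_abs_le_one] at h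
    nlinarith [sq_nonneg (trace (pauliString v * ρ)).re]
  refine ⟨him, ?_, ?_⟩
  · calc ((4 : ℝ) ^ n)⁻¹ * ∑ v : Fin n → Fin 4, (trace (pauliString v * ρ)).re ^ 4
        ≤ ((4 : ℝ) ^ n)⁻¹ * ∑ v : Fin n → Fin 4, (trace (pauliString v * ρ)).re ^ 2 := by
          exact mul_le_mul_of_nonneg_left (Finset.sum_le_sum fun v _ => hfourth v) (by positivity)
      _ = ((2 : ℝ) ^ n)⁻¹ * (trace (ρ * ρ)).re := by
          rw [hparseval, show (4 : ℝ) = 2 * 2 by norm_num, mul_pow]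
          field_simp
  · have h := (Complex.le_def.1 hρ.trace_mul_self_le).1
    rw [hρtr, one_pow, Complex.one_re] at h
    exact mul_le_of_le_one_right (by positivity) h
end

section
/- Let L ≥ 1, let d₁, …, d_L ≥ 1 with d = Σ_ℓ d_ℓ, let I be the disjoint union of the index sets Fin d₁, …, Fin d_L, let λ₁, …, λ_L be real numbers, and let ρ be a d×d density matrix indexed by I with diagonal blocks ρ̃_ℓ (the d_ℓ×d_ℓ submatrix of ρ on block ℓ). For a family (U₁, …, U_L) with each U_ℓ ∈ U(d_ℓ), let U be the block-diagonal unitary on I whose ℓ-th diagonal block is U_ℓ. Define the kernel X₂ᵇ on I × I by X₂ᵇ((ℓ,i),(ℓ,j)) = λ_ℓ · d_ℓ if i = j, X₂ᵇ((ℓ,i),(ℓ,j)) = −λ_ℓ if i ≠ j, and X₂ᵇ(s,t) = 0 when s and t lie in different blocks. Then the integral, over (U₁, …, U_L) distributed according to the product of the Haar probability measures on U(d₁), …, U(d_L), of the quantity Σ_{s,t ∈ I} X₂ᵇ(s,t) · (U ρ U†)_{ss} · (U ρ U†)_{tt} equals Σ_{ℓ=1}^{L} λ_ℓ Tr(ρ̃_ℓ²).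 -/
open MeasureTheory Matrix ComplexOrder

noncomputable instance {d : ℕ} : MeasurableSpace (Matrix (Fin d) (Fin d) ℂ) := borel _
instance {d : ℕ} : BorelSpace (Matrix (Fin d) (Fin d) ℂ) := ⟨rfl⟩

/-- The matrix whose rows `i` and `j` are `(eᵢ ± c eⱼ) / √2` and whose other rows agree with those
of the identity. It is unitary when `|c| = 1`. -/
noncomputable def pairRotation {n : Type*} [DecidableEq n] (i j : n) (c : ℂ) : Matrix n n ℂ :=
  Matrix.of fun k =>
    if k = i then Pi.single i ((√2 : ℝ) : ℂ)⁻¹ + Pi.single j (((√2 : ℝ) : ℂ)⁻¹ * c)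
    else if k = j then Pi.single i ((√2 : ℝ) : ℂ)⁻¹ - Pi.single j (((√2 : ℝ) : ℂ)⁻¹ * c)
    else Pi.single k 1

theorem inv_sqrt_two_mul_self : ((√2 : ℝ) : ℂ)⁻¹ * ((√2 : ℝ) : ℂ)⁻¹ = 1 / 2 := by
  rw [← mul_inv, ← Complex.ofReal_mul, Real.mul_self_sqrt (by norm_num)]
  norm_num

section PairRotation

variable {n : Type*} [DecidableEq n] {i j : n} (c : ℂ)

theorem pairRotation_row_left :
    pairRotation i j c i = Pi.single i ((√2 : ℝ) : ℂ)⁻¹ + Pi.single j (((√2 : ℝ) : ℂ)⁻¹ * c) :=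
  if_pos rfl

theorem pairRotation_row_right (hij : i ≠ j) :
    pairRotation i j c j = Pi.single i ((√2 : ℝ) : ℂ)⁻¹ - Pi.single j (((√2 : ℝ) : ℂ)⁻¹ * c) :=
  (if_neg hij.symm).trans (if_pos rfl)

theorem pairRotation_row_of_ne {k : n} (hki : k ≠ i) (hkj : k ≠ j) :
    pairRotation i j c k = Pi.single k 1 :=
  (if_neg hki).trans (if_neg hkj)

end PairRotation

theorem pairRotation_mem_unitaryGroup {n : Type*} [Fintype n] [DecidableEq n] {i j : n}
    (hij : i ≠ j) {c : ℂ} (hc : c * star c = 1) :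
    pairRotation i j c ∈ Matrix.unitaryGroup n ℂ := by
  have hs := inv_sqrt_two_mul_self
  simp only [RCLike.star_def] at hc
  rw [Matrix.mem_unitaryGroup_iff]
  ext k l
  rw [Matrix.mul_apply']
  change pairRotation i j c k ⬝ᵥ star (pairRotation i j c l) = _
  rw [Matrix.one_apply]
  rcases eq_or_ne k i with rfl | hki
  · rcases eq_or_ne l k with rfl | hlk
    · simp [pairRotation_row_left, hij, hij.symm]
      grind
    · rcases eq_or_ne l j with rfl | hlj
      · simp [pairRotation_row_left, pairRotation_row_right, hij, hij.symm]
        grind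
      · simp [pairRotation_row_left, pairRotation_row_of_ne, hlk, hlj, hlk.symm]
  · rcases eq_or_ne k j with rfl | hkj
    · rcases eq_or_ne l i with rfl | hli
      · simp [pairRotation_row_left, pairRotation_row_right, hij, hij.symm]
        grind
      · rcases eq_or_ne l k with rfl | hlk
        · simp [pairRotation_row_right, hij, hij.symm]
          grind
        · simp [pairRotation_row_right, pairRotation_row_of_ne, hij, hlk, hli, hlk.symm]
    · rw [pairRotation_row_of_ne c hki hkj]
      rcases eq_or_ne l i with rfl | hli
      · simp [pairRotation_row_left, hki, hkj]
      · rcases eq_or_ne l j with rfl | hlj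
        · simp [pairRotation_row_right, hij, hki, hkj]
        · simp [pairRotation_row_of_ne, hli, hlj, Pi.single_apply, eq_comm]

theorem mul_mul_conjTranspose_apply_self {n : Type*} [Fintype n] (W B : Matrix n n ℂ) (k : n) :
    (W * B * Wᴴ) k k = W k ⬝ᵥ B *ᵥ star (W k) := by
  rw [Matrix.mul_assoc, Matrix.mul_apply']
  rfl

theorem pairRotation_conj_apply_left {n : Type*} [Fintype n] [DecidableEq n] (i j : n)
    (c : ℂ) (hc : c * star c = 1) (B : Matrix n n ℂ) :
    (pairRotation i j c * B * (pairRotation i j c)ᴴ) i i =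
      (B i i + B j j + star c * B i j + c * B j i) / 2 := by
  have hs := inv_sqrt_two_mul_self
  rw [mul_mul_conjTranspose_apply_self, pairRotation_row_left]
  simp [Matrix.mulVec_add, star_add, Pi.star_single] at hc ⊢
  grind

theorem pairRotation_conj_apply_right {n : Type*} [Fintype n] [DecidableEq n] {i j : n}
    (hij : i ≠ j) (c : ℂ) (hc : c * star c = 1) (B : Matrix n n ℂ) :
    (pairRotation i j c * B * (pairRotation i j c)ᴴ) j j =
      (B i i + B j j - star c * B i j - c * B j i) / 2 := by
  have hs := inv_sqrt_two_mul_self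
  rw [mul_mul_conjTranspose_apply_self, pairRotation_row_right c hij]
  simp [Matrix.mulVec_sub, star_sub, Pi.star_single] at hc ⊢
  grind

/-- The quadratic identity which, averaged over the unitary group, determines the second
moments of `U A U†`. -/
theorem sum_sq_pairRotation_conj {n : Type*} [Fintype n] [DecidableEq n] {i j : n}
    (hij : i ≠ j) (B : Matrix n n ℂ) :
    (pairRotation i j 1 * B * (pairRotation i j 1)ᴴ) i i ^ 2 +
      (pairRotation i j 1 * B * (pairRotation i j 1)ᴴ) j j ^ 2 +
      ((pairRotation i j Complex.I * B * (pairRotation i j Complex.I)ᴴ) i i ^ 2 +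
      (pairRotation i j Complex.I * B * (pairRotation i j Complex.I)ᴴ) j j ^ 2) =
    B i i ^ 2 + B j j ^ 2 + 2 * (B i i * B j j) + 2 * (B i j * B j i) := by
  have h1 : (1 : ℂ) * star 1 = 1 := by simp
  have hI : Complex.I * star Complex.I = 1 := by simp
  rw [pairRotation_conj_apply_left i j 1 h1, pairRotation_conj_apply_right hij 1 h1,
    pairRotation_conj_apply_left i j _ hI, pairRotation_conj_apply_right hij _ hI]
  simp only [star_one, RCLike.star_def, Complex.conj_I]
  linear_combination (1 / 2 * (B i j - B j i) ^ 2) * Complex.I_sq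

section UnitaryMoments

variable {d : ℕ}

theorem continuous_unitary_conj_apply (A : Matrix (Fin d) (Fin d) ℂ) (i j : Fin d) :
    Continuous fun U : Matrix.unitaryGroup (Fin d) ℂ =>
      ((U : Matrix (Fin d) (Fin d) ℂ) * A * (U : Matrix (Fin d) (Fin d) ℂ)ᴴ) i j := by
  have h : Continuous fun U : Matrix.unitaryGroup (Fin d) ℂ =>
      (U : Matrix (Fin d) (Fin d) ℂ) * A * (U : Matrix (Fin d) (Fin d) ℂ)ᴴ :=
    (continuous_subtype_val.matrix_mul continuous_const).matrix_mul
      continuous_subtype_val.matrix_conjTranspose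
  exact h.matrix_elem i j

theorem norm_unitary_conj_apply_le (A : Matrix (Fin d) (Fin d) ℂ) (i j : Fin d)
    (U : Matrix.unitaryGroup (Fin d) ℂ) :
    ‖((U : Matrix (Fin d) (Fin d) ℂ) * A * (U : Matrix (Fin d) (Fin d) ℂ)ᴴ) i j‖ ≤
      ∑ k, ∑ l, ‖A l k‖ := by
  rw [Matrix.mul_apply]
  refine norm_sum_le_of_le _ fun k _ => ?_
  rw [norm_mul, Matrix.conjTranspose_apply, norm_star]
  refine (mul_le_of_le_one_right (norm_nonneg _) (entry_norm_bound_of_unitary U.2 j k)).trans ?_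
  rw [Matrix.mul_apply]
  refine norm_sum_le_of_le _ fun l _ => ?_
  rw [norm_mul]
  exact mul_le_of_le_one_left (norm_nonneg _) (entry_norm_bound_of_unitary U.2 i l)

variable (μ : Measure (Matrix.unitaryGroup (Fin d) ℂ))

theorem integrable_unitary_conj_mul [IsFiniteMeasure μ]
    (A : Matrix (Fin d) (Fin d) ℂ) (i j k l : Fin d) :
    Integrable (fun U : Matrix.unitaryGroup (Fin d) ℂ =>
      ((U : Matrix (Fin d) (Fin d) ℂ) * A * (U : Matrix (Fin d) (Fin d) ℂ)ᴴ) i j *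
      ((U : Matrix (Fin d) (Fin d) ℂ) * A * (U : Matrix (Fin d) (Fin d) ℂ)ᴴ) k l) μ := by
  refine Integrable.of_bound (C := (∑ k, ∑ l, ‖A l k‖) * ∑ k, ∑ l, ‖A l k‖) ?_
    (Filter.Eventually.of_forall fun U => ?_)
  · exact ((continuous_unitary_conj_apply A i j).mul
      (continuous_unitary_conj_apply A k l)).measurable.aestronglyMeasurable
  · rw [norm_mul]
    exact mul_le_mul (norm_unitary_conj_apply_le A i j U) (norm_unitary_conj_apply_le A k l U)
      (norm_nonneg _) (by positivity)

/-- The second moments of the entries of `U A U†`. -/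
noncomputable def unitaryMoment (A : Matrix (Fin d) (Fin d) ℂ) (i j k l : Fin d) : ℂ :=
  ∫ U : Matrix.unitaryGroup (Fin d) ℂ,
    ((U : Matrix (Fin d) (Fin d) ℂ) * A * (U : Matrix (Fin d) (Fin d) ℂ)ᴴ) i j *
    ((U : Matrix (Fin d) (Fin d) ℂ) * A * (U : Matrix (Fin d) (Fin d) ℂ)ᴴ) k l ∂μ

theorem integral_rotated_sq [μ.IsMulLeftInvariant]
    (A : Matrix (Fin d) (Fin d) ℂ) (k : Fin d) (W : Matrix.unitaryGroup (Fin d) ℂ) :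
    ∫ U : Matrix.unitaryGroup (Fin d) ℂ,
      ((W : Matrix (Fin d) (Fin d) ℂ) *
        ((U : Matrix (Fin d) (Fin d) ℂ) * A * (U : Matrix (Fin d) (Fin d) ℂ)ᴴ) *
        (W : Matrix (Fin d) (Fin d) ℂ)ᴴ) k k ^ 2 ∂μ = unitaryMoment μ A k k k k := by
  refine Eq.trans ?_ (integral_mul_left_eq_self _ W)
  congr with U
  simp [Matrix.conjTranspose_mul, Matrix.mul_assoc, sq]

theorem integrable_rotated_sq [IsFiniteMeasure μ] [μ.IsMulLeftInvariant]
    (A : Matrix (Fin d) (Fin d) ℂ) (k : Fin d) (W : Matrix.unitaryGroup (Fin d) ℂ) :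
    Integrable (fun U : Matrix.unitaryGroup (Fin d) ℂ =>
      ((W : Matrix (Fin d) (Fin d) ℂ) *
        ((U : Matrix (Fin d) (Fin d) ℂ) * A * (U : Matrix (Fin d) (Fin d) ℂ)ᴴ) *
        (W : Matrix (Fin d) (Fin d) ℂ)ᴴ) k k ^ 2) μ := by
  convert (integrable_unitary_conj_mul μ A k k k k).comp_mul_left W using 2 with U
  simp [Matrix.conjTranspose_mul, Matrix.mul_assoc, sq]

theorem unitaryMoment_diag_add_diag [IsFiniteMeasure μ] [μ.IsMulLeftInvariant]
    (A : Matrix (Fin d) (Fin d) ℂ) {i j : Fin d} (hij : i ≠ j) :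
    unitaryMoment μ A i i i i + unitaryMoment μ A j j j j =
      2 * unitaryMoment μ A i i j j + 2 * unitaryMoment μ A i j j i := by
  let V : Matrix.unitaryGroup (Fin d) ℂ :=
    ⟨pairRotation i j 1, pairRotation_mem_unitaryGroup hij (by simp)⟩
  let W : Matrix.unitaryGroup (Fin d) ℂ :=
    ⟨pairRotation i j Complex.I, pairRotation_mem_unitaryGroup hij (by simp)⟩
  have key := integral_congr_ae (μ := μ) (Filter.Eventually.of_forall
    fun U : Matrix.unitaryGroup (Fin d) ℂ => sum_sq_pairRotation_conj hij
      ((U : Matrix (Fin d) (Fin d) ℂ) * A * (U : Matrix (Fin d) (Fin d) ℂ)ᴴ))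
  have hVi := integrable_rotated_sq μ A i V
  have hVj := integrable_rotated_sq μ A j V
  have hWi := integrable_rotated_sq μ A i W
  have hWj := integrable_rotated_sq μ A j W
  have hi := integrable_unitary_conj_mul μ A i i i i
  have hj := integrable_unitary_conj_mul μ A j j j j
  have hp := (integrable_unitary_conj_mul μ A i i j j).const_mul 2
  have hr := (integrable_unitary_conj_mul μ A i j j i).const_mul 2
  have hl := integral_add (hVi.add hVj) (hWi.add hWj)
  have hl' := integral_add hVi hVj
  have hl'' := integral_add hWi hWj
  have hq := integral_add ((hi.add hj).add hp) hr
  have hq' := integral_add (hi.add hj) hp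
  have hq'' := integral_add hi hj
  rw [integral_rotated_sq, integral_rotated_sq] at hl' hl''
  rw [integral_const_mul] at hq hq'
  simp only [Pi.add_apply] at hl hq hq'
  rw [hl', hl''] at hl
  rw [hq', hq''] at hq
  simp only [pow_two] at key hl
  have e := hl.symm.trans (key.trans hq)
  simp only [unitaryMoment] at e ⊢
  linear_combination e

theorem sum_unitaryMoment_eq_trace [IsProbabilityMeasure μ]
    (A : Matrix (Fin d) (Fin d) ℂ) :
    ∑ i, ∑ j, unitaryMoment μ A i j j i = (A * A).trace := by
  have h (U : Matrix.unitaryGroup (Fin d) ℂ) :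
      ∑ i, ∑ j, ((U : Matrix (Fin d) (Fin d) ℂ) * A * (U : Matrix (Fin d) (Fin d) ℂ)ᴴ) i j *
        ((U : Matrix (Fin d) (Fin d) ℂ) * A * (U : Matrix (Fin d) (Fin d) ℂ)ᴴ) j i =
      (A * A).trace := by
    have hU : (U : Matrix (Fin d) (Fin d) ℂ)ᴴ * (U : Matrix (Fin d) (Fin d) ℂ) = 1 :=
      Matrix.mem_unitaryGroup_iff'.1 U.2
    calc
      _ = (((U : Matrix (Fin d) (Fin d) ℂ) * A * (U : Matrix (Fin d) (Fin d) ℂ)ᴴ) *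
          ((U : Matrix (Fin d) (Fin d) ℂ) * A * (U : Matrix (Fin d) (Fin d) ℂ)ᴴ)).trace := by
        simp only [Matrix.trace, Matrix.diag_apply]
        exact Finset.sum_congr rfl fun i _ => (Matrix.mul_apply ..).symm
      _ = ((U : Matrix (Fin d) (Fin d) ℂ) * (A * A) * (U : Matrix (Fin d) (Fin d) ℂ)ᴴ).trace := by
        congr 1
        simp only [Matrix.mul_assoc]
        rw [← Matrix.mul_assoc _ᴴ (U : Matrix (Fin d) (Fin d) ℂ), hU, Matrix.one_mul]
      _ = (A * A).trace := by rw [Matrix.trace_mul_comm, ← Matrix.mul_assoc, hU, Matrix.one_mul]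
  simp only [unitaryMoment]
  simp_rw [← integral_finsetSum Finset.univ fun j _ => integrable_unitary_conj_mul μ A _ j j _]
  rw [← integral_finsetSum _ fun i _ => integrable_finsetSum _ fun j _ =>
    integrable_unitary_conj_mul μ A i j j i]
  simp [h]

theorem sum_kernel_mul_unitaryMoment [IsProbabilityMeasure μ] [μ.IsMulLeftInvariant]
    (A : Matrix (Fin d) (Fin d) ℂ) :
    ∑ i, ∑ j, (if i = j then (d : ℂ) else -1) * unitaryMoment μ A i i j j = (A * A).trace := by
  rw [← sum_unitaryMoment_eq_trace μ A, ← sub_eq_zero]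
  have h (i j : Fin d) :
      (if i = j then (d : ℂ) else -1) * unitaryMoment μ A i i j j - unitaryMoment μ A i j j i =
      (if i = j then (d : ℂ) * unitaryMoment μ A i i i i else 0) -
        (unitaryMoment μ A i i i i + unitaryMoment μ A j j j j) / 2 := by
    by_cases hij : i = j
    · subst hij
      simp
    · rw [unitaryMoment_diag_add_diag μ A hij]
      simp only [hij, if_false]
      ring
  simp only [← Finset.sum_sub_distrib, h]
  simp only [Finset.sum_sub_distrib, ← Finset.sum_div, Finset.sum_add_distrib]
  simp [← Finset.mul_sum]

theorem integrable_block_estimator [IsFiniteMeasure μ] (A : Matrix (Fin d) (Fin d) ℂ) :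
    Integrable (fun U : Matrix.unitaryGroup (Fin d) ℂ =>
      ∑ i, ∑ j, (if i = j then (d : ℂ) else -1) *
        (((U : Matrix (Fin d) (Fin d) ℂ) * A * (U : Matrix (Fin d) (Fin d) ℂ)ᴴ) i i *
        ((U : Matrix (Fin d) (Fin d) ℂ) * A * (U : Matrix (Fin d) (Fin d) ℂ)ᴴ) j j)) μ :=
  integrable_finsetSum _ fun i _ => integrable_finsetSum _ fun j _ =>
    (integrable_unitary_conj_mul μ A i i j j).const_mul _

/-- The randomized-measurement estimator of the purity on a single block is unbiased. -/
theorem integral_block_estimator [IsProbabilityMeasure μ] [μ.IsMulLeftInvariant]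
    (A : Matrix (Fin d) (Fin d) ℂ) :
    ∫ U : Matrix.unitaryGroup (Fin d) ℂ,
      ∑ i, ∑ j, (if i = j then (d : ℂ) else -1) *
        (((U : Matrix (Fin d) (Fin d) ℂ) * A * (U : Matrix (Fin d) (Fin d) ℂ)ᴴ) i i *
        ((U : Matrix (Fin d) (Fin d) ℂ) * A * (U : Matrix (Fin d) (Fin d) ℂ)ᴴ) j j) ∂μ =
      (A * A).trace := by
  rw [← sum_kernel_mul_unitaryMoment μ A, integral_finsetSum _ fun i _ =>
    integrable_finsetSum _ fun j _ => (integrable_unitary_conj_mul μ A i i j j).const_mul _]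
  refine Finset.sum_congr rfl fun i _ => ?_
  rw [integral_finsetSum _ fun j _ => (integrable_unitary_conj_mul μ A i i j j).const_mul _]
  exact Finset.sum_congr rfl fun j _ => integral_const_mul _ _

end UnitaryMoments

theorem blockDiagonal'_conj_apply {o : Type*} [Fintype o] [DecidableEq o] {n : o → Type*}
    [∀ ℓ, Fintype (n ℓ)] (U : ∀ ℓ, Matrix (n ℓ) (n ℓ) ℂ)
    (ρ : Matrix (Σ ℓ, n ℓ) (Σ ℓ, n ℓ) ℂ) (ℓ : o) (i j : n ℓ) :
    (Matrix.blockDiagonal' U * ρ * (Matrix.blockDiagonal' U)ᴴ) ⟨ℓ, i⟩ ⟨ℓ, j⟩ =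
      (U ℓ * (Matrix.of fun i j => ρ ⟨ℓ, i⟩ ⟨ℓ, j⟩) * (U ℓ)ᴴ) i j := by
  have h (f : (Σ ℓ, n ℓ) → ℂ) (k : n ℓ) :
      ∑ s, Matrix.blockDiagonal' U ⟨ℓ, k⟩ s * f s = ∑ l, U ℓ k l * f ⟨ℓ, l⟩ := by
    rw [Fintype.sum_sigma, Finset.sum_eq_single ℓ]
    · simp
    · intro m _ hm
      simp [Matrix.blockDiagonal'_apply_ne _ _ _ hm.symm]
    · simp
  have h' (f : (Σ ℓ, n ℓ) → ℂ) (k : n ℓ) :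
      ∑ s, f s * star (Matrix.blockDiagonal' U ⟨ℓ, k⟩ s) = ∑ l, f ⟨ℓ, l⟩ * star (U ℓ k l) := by
    rw [Fintype.sum_sigma, Finset.sum_eq_single ℓ]
    · simp
    · intro m _ hm
      simp [Matrix.blockDiagonal'_apply_ne _ _ _ hm.symm]
    · simp
  rw [Matrix.mul_apply, Matrix.mul_apply]
  simp only [Matrix.conjTranspose_apply]
  rw [h']
  simp only [Matrix.mul_apply, h, Matrix.of_apply]

/-- Unbiasedness of the block-diagonal randomized-measurement estimator:
for a density matrix `ρ` on the disjoint union `I = Σ ℓ, Fin (dv ℓ)`, averaging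
`Σ_{s,t} X₂ᵇ(s,t) (UρU†)_{ss} (UρU†)_{tt}` over independent Haar-random blocks
`U = ⊕_ℓ U_ℓ` yields `Σ_ℓ λ_ℓ Tr(ρ̃_ℓ²)`, where `ρ̃_ℓ` are the diagonal blocks of `ρ`,
and `X₂ᵇ((ℓ,i),(ℓ,j)) = λ_ℓ d_ℓ` if `i = j`, `= −λ_ℓ` if `i ≠ j`, and `0` across blocks. -/
theorem blockDiagonal_estimator_unbiased {L : ℕ} (hL : 1 ≤ L)
    (dv : Fin L → ℕ) (hdv : ∀ ℓ, 1 ≤ dv ℓ) (lam : Fin L → ℝ)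
    (ρ : Matrix (Σ ℓ, Fin (dv ℓ)) (Σ ℓ, Fin (dv ℓ)) ℂ)
    (hρ : ρ.PosSemidef) (hρtr : ρ.trace = 1)
    (μ : ∀ ℓ, Measure (Matrix.unitaryGroup (Fin (dv ℓ)) ℂ))
    [∀ ℓ, (μ ℓ).IsHaarMeasure] [∀ ℓ, IsProbabilityMeasure (μ ℓ)] :
    (∫ Uf : ∀ ℓ, Matrix.unitaryGroup (Fin (dv ℓ)) ℂ,
      (∑ s : Σ ℓ, Fin (dv ℓ), ∑ t : Σ ℓ, Fin (dv ℓ),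
        (if s.1 = t.1 then
            (if s = t then (lam s.1 : ℂ) * (dv s.1 : ℂ) else -(lam s.1 : ℂ))
          else 0) *
        ((Matrix.blockDiagonal' (fun ℓ => (Uf ℓ : Matrix (Fin (dv ℓ)) (Fin (dv ℓ)) ℂ)) * ρ *
          (Matrix.blockDiagonal' (fun ℓ => (Uf ℓ : Matrix (Fin (dv ℓ)) (Fin (dv ℓ)) ℂ)))ᴴ) s s) *
        ((Matrix.blockDiagonal' (fun ℓ => (Uf ℓ : Matrix (Fin (dv ℓ)) (Fin (dv ℓ)) ℂ)) * ρ *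
          (Matrix.blockDiagonal' (fun ℓ => (Uf ℓ : Matrix (Fin (dv ℓ)) (Fin (dv ℓ)) ℂ)))ᴴ) t t))
      ∂(Measure.pi μ)) =
    ∑ ℓ : Fin L, (lam ℓ : ℂ) *
      Matrix.trace ((Matrix.of fun i j => ρ ⟨ℓ, i⟩ ⟨ℓ, j⟩) * (Matrix.of fun i j => ρ ⟨ℓ, i⟩ ⟨ℓ, j⟩)) := by
  have key (Uf : ∀ ℓ, Matrix.unitaryGroup (Fin (dv ℓ)) ℂ) :
      (∑ s : Σ ℓ, Fin (dv ℓ), ∑ t : Σ ℓ, Fin (dv ℓ),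
        (if s.1 = t.1 then
            (if s = t then (lam s.1 : ℂ) * (dv s.1 : ℂ) else -(lam s.1 : ℂ))
          else 0) *
        ((Matrix.blockDiagonal' (fun ℓ => (Uf ℓ : Matrix (Fin (dv ℓ)) (Fin (dv ℓ)) ℂ)) * ρ *
          (Matrix.blockDiagonal' (fun ℓ => (Uf ℓ : Matrix (Fin (dv ℓ)) (Fin (dv ℓ)) ℂ)))ᴴ) s s) *
        ((Matrix.blockDiagonal' (fun ℓ => (Uf ℓ : Matrix (Fin (dv ℓ)) (Fin (dv ℓ)) ℂ)) * ρ *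
          (Matrix.blockDiagonal' (fun ℓ => (Uf ℓ : Matrix (Fin (dv ℓ)) (Fin (dv ℓ)) ℂ)))ᴴ) t t)) =
      ∑ ℓ, (lam ℓ : ℂ) * ∑ i, ∑ j, (if i = j then (dv ℓ : ℂ) else -1) *
        (((Uf ℓ : Matrix (Fin (dv ℓ)) (Fin (dv ℓ)) ℂ) *
          (Matrix.of fun i j => ρ ⟨ℓ, i⟩ ⟨ℓ, j⟩) *
          (Uf ℓ : Matrix (Fin (dv ℓ)) (Fin (dv ℓ)) ℂ)ᴴ) i i *
        ((Uf ℓ : Matrix (Fin (dv ℓ)) (Fin (dv ℓ)) ℂ) *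
          (Matrix.of fun i j => ρ ⟨ℓ, i⟩ ⟨ℓ, j⟩) *
          (Uf ℓ : Matrix (Fin (dv ℓ)) (Fin (dv ℓ)) ℂ)ᴴ) j j) := by
    rw [Fintype.sum_sigma]
    refine Finset.sum_congr rfl fun ℓ _ => ?_
    rw [Finset.mul_sum]
    refine Finset.sum_congr rfl fun i _ => ?_
    rw [Fintype.sum_sigma, Finset.sum_eq_single ℓ, Finset.mul_sum]
    · refine Finset.sum_congr rfl fun j _ => ?_
      rw [blockDiagonal'_conj_apply, blockDiagonal'_conj_apply]
      by_cases hij : i = j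
      · simp [hij]
        ring
      · simp [hij]
        ring
    · intro m _ hm
      simp [hm.symm]
    · simp
  simp only [key]
  have hest (ℓ : Fin L) := integrable_block_estimator (μ ℓ)
    (Matrix.of fun i j => ρ ⟨ℓ, i⟩ ⟨ℓ, j⟩)
  refine (integral_finsetSum _ fun ℓ _ =>
    ((measurePreserving_eval μ ℓ).integrable_comp_of_integrable (hest ℓ)).const_mul _).trans ?_
  refine Finset.sum_congr rfl fun ℓ _ => ?_
  rw [integral_const_mul, ← integral_block_estimator (μ ℓ)]
  congr 1
  have hmp := measurePreserving_eval μ ℓ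
  have hm := (hest ℓ).aestronglyMeasurable
  rw [← hmp.map_eq] at hm
  rw [← hmp.map_eq, integral_map hmp.aemeasurable hm]
  rfl
end
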